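/- Let k be an algebraically closed field, G a finite group acting faithfully and linearly on a finite-dimensional k-vector space V with |G| invertible in k, and let H ≤ G be the (normal) subgroup generated by pseudo-reflections. Then k[V]^H is a polynomial ring (by the classical Chevalley–Shephard–Todd theorem), and the induced action of G/H on k[V]^H is faithful. -/

import Mathlib

open Module MvPolynomial

/-- The subalgebra of invariants of a subgroup `H` acting on a `k`-algebra `A`
through algebra automorphisms `σ`. -/
def invariantSubalgebra {k A G : Type*} [CommSemiring k] [CommSemiring A] [Algebra k A]
    [Group G] (σ : G →* (A ≃ₐ[k] A)) (H : Subgroup G) : Subalgebra k A where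
  carrier := {x | ∀ h ∈ H, σ h x = x}
  mul_mem' {x y} hx hy := fun h hh => by
    simp only [Set.mem_setOf_eq] at *
    rw [map_mul, hx h hh, hy h hh]
  add_mem' {x y} hx hy := fun h hh => by
    simp only [Set.mem_setOf_eq] at *
    rw [map_add, hx h hh, hy h hh]
  algebraMap_mem' r := fun h hh => (σ h).commutes r


namespace CST
open ExteriorAlgebra

section Koszul
variable {S : Type*} [CommRing S] {n : ℕ} {κ : Type*}

/-- Vanishing of long products in the exterior algebra of a free module of rank `n`. -/
lemma prod_eq_zero (a : κ → Fin n → S) (l : List κ) (hl : n < l.length) :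
    (l.map fun i => ExteriorAlgebra.ι S (a i)).prod = 0 := by
  have h0 : ExteriorAlgebra.ιMulti S l.length (M := Fin n → S) = 0 := by
    refine Module.Basis.ext_alternating (Pi.basisFun S (Fin n)) fun v hv => ?_
    have := Fintype.card_le_of_injective v hv
    simp at this
    omega
  have := congrArg (fun F => F (fun j => a (l.get j))) h0
  simp only [ExteriorAlgebra.ιMulti_apply, AlternatingMap.zero_apply] at this
  rw [← this]
  congr 1
  conv_lhs => rw [← List.ofFn_get l, List.map_ofFn]
  rfl

variable (x : Fin n → S)

/-- The Koszul functional. -/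
noncomputable def kd : Module.Dual S (Fin n → S) := Fintype.linearCombination S x

/-- The Koszul differential. -/
noncomputable def kD : ExteriorAlgebra S (Fin n → S) →ₗ[S] ExteriorAlgebra S (Fin n → S) :=
  CliffordAlgebra.contractLeft (Q := (0 : QuadraticForm S (Fin n → S))) (kd x)

lemma kd_apply (a : Fin n → S) : kd x a = ∑ j, a j * x j := by
  simp [kd, Fintype.linearCombination_apply]

lemma kD_mul (a : Fin n → S) (b : ExteriorAlgebra S (Fin n → S)) :
    kD x (ExteriorAlgebra.ι S a * b) = kd x a • b - ExteriorAlgebra.ι S a * kD x b :=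
  CliffordAlgebra.contractLeft_ι_mul _ _ _

lemma kD_kD (b : ExteriorAlgebra S (Fin n → S)) : kD x (kD x b) = 0 :=
  CliffordAlgebra.contractLeft_contractLeft _ _

lemma kD_one : kD x 1 = 0 := CliffordAlgebra.contractLeft_one _ _

lemma inv_kD (b : ExteriorAlgebra S (Fin n → S)) :
    ExteriorAlgebra.algebraMapInv (kD x b) ∈ Ideal.span (Set.range x) := by
  refine CliffordAlgebra.left_induction (Q := (0 : QuadraticForm S (Fin n → S)))
    (P := fun b => ExteriorAlgebra.algebraMapInv (kD x b) ∈ Ideal.span (Set.range x)) ?_ ?_ ?_ b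
  · intro r
    have : kD x (algebraMap S _ r) = 0 := CliffordAlgebra.contractLeft_algebraMap _ _ _
    rw [show kD x ((algebraMap S (CliffordAlgebra (0 : QuadraticForm S (Fin n → S)))) r) = 0 from this]
    simp
  · intro u v hu hv
    simp only [map_add]
    exact add_mem hu hv
  · intro u m hu
    have := kD_mul x m u
    rw [show kD x (CliffordAlgebra.ι (0 : QuadraticForm S (Fin n → S)) m * u) = _ from this]
    simp only [map_sub, map_smul, map_mul, smul_eq_mul]
    have h1 : algebraMapInv (ExteriorAlgebra.ι S m) = (0 : S) := by simp [algebraMapInv]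
    rw [h1, zero_mul, sub_zero]
    apply Ideal.mul_mem_right
    rw [kd_apply]
    exact sum_mem fun j _ => Ideal.mul_mem_left _ _ (Ideal.subset_span ⟨j, rfl⟩)

variable (f : κ → S)

lemma fs_add {E : Type*} [AddCommGroup E] [Module S E] (η θ : κ →₀ E) :
    ((η + θ).sum fun i e => f i • e) = (η.sum fun i e => f i • e) + θ.sum fun i e => f i • e := by
  classical
  exact Finsupp.sum_add_index' (fun _ => smul_zero _) (fun i e e' => smul_add _ _ _)

lemma fs_single {E : Type*} [AddCommGroup E] [Module S E] (i : κ) (e : E) :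
    ((Finsupp.single i e).sum fun i e => f i • e) = f i • e :=
  Finsupp.sum_single_index (smul_zero _)

lemma fs_map {E : Type*} [AddCommGroup E] [Module S E] (η : κ →₀ E) (g : E → E) (hg : g 0 = 0) :
    ((η.mapRange g hg).sum fun i e => f i • e) = η.sum fun i e => f i • g e :=
  Finsupp.sum_mapRange_index fun _ => smul_zero _

lemma mem_smul_exists {E : Type*} [AddCommGroup E] [Module S E] (b : E)
    (hb : b ∈ (Ideal.span (Set.range f)) • (⊤ : Submodule S E)) :
    ∃ η : κ →₀ E, b = η.sum fun i e => f i • e := by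
  classical
  refine Submodule.smul_induction_on hb ?_ ?_
  · intro r hr e _
    induction hr using Submodule.span_induction with
    | mem y hy =>
      obtain ⟨i, rfl⟩ := hy
      exact ⟨Finsupp.single i e, by simp⟩
    | zero => exact ⟨0, by simp⟩
    | add u v _ _ hu hv =>
      obtain ⟨η, h⟩ := hu
      obtain ⟨θ, h'⟩ := hv
      exact ⟨η + θ, by rw [fs_add, add_smul, h, h']⟩
    | smul s u _ hu =>
      obtain ⟨η, h⟩ := hu
      refine ⟨η.mapRange (fun e => s • e) (smul_zero _), ?_⟩
      rw [fs_map, smul_assoc, h, Finsupp.smul_sum]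
      exact Finsupp.sum_congr fun i _ => smul_comm _ _ _
  · intro u v hu hv
    obtain ⟨η, h⟩ := hu
    obtain ⟨θ, h'⟩ := hv
    exact ⟨η + θ, by rw [fs_add, h, h']⟩

lemma xs_add (η θ : κ →₀ ExteriorAlgebra S (Fin n → S)) :
    ((η + θ).sum fun i e => f i • e) = (η.sum fun i e => f i • e) + θ.sum fun i e => f i • e := by
  classical
  exact Finsupp.sum_add_index' (fun _ => smul_zero _) (fun i e e' => smul_add _ _ _)

lemma xs_single (i : κ) (e : ExteriorAlgebra S (Fin n → S)) :
    ((Finsupp.single i e).sum fun i e => f i • e) = f i • e :=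
  Finsupp.sum_single_index (smul_zero _)

lemma xs_map (η : κ →₀ ExteriorAlgebra S (Fin n → S)) (g : ExteriorAlgebra S (Fin n → S) → ExteriorAlgebra S (Fin n → S)) (hg : g 0 = 0) :
    ((η.mapRange g hg).sum fun i e => f i • e) = η.sum fun i e => f i • g e :=
  Finsupp.sum_mapRange_index fun _ => smul_zero _

/-- Relations with coefficients in the exterior algebra. -/
lemma rel_ext (hI : ∀ p : κ →₀ S, (p.sum fun i c => c * f i) = 0 →
      ∀ i, p i ∈ Ideal.span (Set.range f))
    (η : κ →₀ ExteriorAlgebra S (Fin n → S)) (h : (η.sum fun i e => f i • e) = 0) (i : κ) :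
    η i ∈ (Ideal.span (Set.range f)) • (⊤ : Submodule S (ExteriorAlgebra S (Fin n → S))) := by
  let B := (Pi.basisFun S (Fin n)).ExteriorAlgebra
  rw [← B.sum_repr (η i)]
  refine sum_mem fun t _ => Submodule.smul_mem_smul ?_ trivial
  have := hI (η.mapRange (fun e => B.repr e t) (by simp)) ?_ i
  · simpa using this
  · rw [Finsupp.sum_mapRange_index (by simp)]
    have h2 := congrArg (fun e => B.repr e t) h
    simp only [Finsupp.sum, map_sum, map_smul, Finsupp.coe_finsetSum, Finset.sum_apply,
      Finsupp.smul_apply, smul_eq_mul, map_zero, Finsupp.zero_apply] at h2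
    rw [← h2]
    exact Finset.sum_congr rfl fun i _ => mul_comm _ _

variable (a : κ → Fin n → S)

lemma kD_prod (hf : ∀ i, kd x (a i) = f i) (i : κ) (l : List κ) (hi : i ∉ l) :
    ∃ η : κ →₀ ExteriorAlgebra S (Fin n → S), η i = 0 ∧
      kD x (l.map fun i => ExteriorAlgebra.ι S (a i)).prod = η.sum fun i e => f i • e := by
  classical
  induction l with
  | nil => exact ⟨0, rfl, by simp [kD_one]⟩
  | cons j l ih =>
    simp only [List.mem_cons, not_or] at hi
    obtain ⟨η, h0, h⟩ := ih hi.2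
    refine ⟨Finsupp.single j (l.map fun i => ExteriorAlgebra.ι S (a i)).prod +
      η.mapRange (fun e => - (ExteriorAlgebra.ι S (a j) * e)) (by simp), ?_, ?_⟩
    · simp [h0, Ne.symm hi.1]
    · rw [xs_add, xs_single,
        xs_map, List.map_cons, List.prod_cons, kD_mul, hf, h,
        sub_eq_add_neg]
      congr 1
      rw [Finsupp.mul_sum, Finsupp.sum, Finsupp.sum, ← Finset.sum_neg_distrib]
      exact Finset.sum_congr rfl fun i _ => by simp

/-- The Koszul argument bounding the number of generators. -/
theorem length_le (hx : (1 : S) ∉ Ideal.span (Set.range x))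
    (hf : ∀ i, kd x (a i) = f i)
    (hI : ∀ p : κ →₀ S, (p.sum fun i c => c * f i) = 0 →
      ∀ i, p i ∈ Ideal.span (Set.range f))
    (l : List κ) (hl : l.Nodup) : l.length ≤ n := by
  classical
  by_contra! hlt
  let T : Submodule S (ExteriorAlgebra S (Fin n → S)) :=
    (Ideal.span (Set.range f)) • ⊤ ⊔ LinearMap.range (kD x)
  have key : ∀ l : List κ, l.Nodup → (l.map fun i => ExteriorAlgebra.ι S (a i)).prod ∈ T →
      (1 : ExteriorAlgebra S (Fin n → S)) ∈ T := by
    intro l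
    induction l with
    | nil => intro _ h; simpa using h
    | cons i l ih =>
      intro hnd h
      rw [List.nodup_cons] at hnd
      refine ih hnd.2 ?_
      obtain ⟨u, hu, v, ⟨w, rfl⟩, huv⟩ := Submodule.mem_sup.1 h
      obtain ⟨γ, rfl⟩ := mem_smul_exists f u hu
      obtain ⟨η, h0, h1⟩ := kD_prod x f a hf i l hnd.1
      have h2 := congrArg (kD x) huv
      rw [List.map_cons, List.prod_cons, kD_mul, map_add, kD_kD, add_zero, h1, hf] at h2
      set Z := (l.map fun i => ExteriorAlgebra.ι S (a i)).prod with hZ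
      have h3 := rel_ext f hI (Finsupp.single i Z +
        (η.mapRange (fun e => - (ExteriorAlgebra.ι S (a i) * e)) (by simp) +
        γ.mapRange (fun e => - kD x e) (by simp))) ?_ i
      · simp only [Finsupp.add_apply, Finsupp.single_eq_same, Finsupp.mapRange_apply, h0, mul_zero,
          neg_zero, zero_add] at h3
        have h4 : Z = (Z + -kD x (γ i)) + kD x (γ i) := by abel
        rw [h4]
        exact Submodule.add_mem_sup h3 ⟨_, rfl⟩
      · rw [xs_add, xs_add,
          xs_single, xs_map,
          xs_map]
        have e1 : (η.sum fun j e => f j • -(ExteriorAlgebra.ι S (a i) * e)) =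
            - (ExteriorAlgebra.ι S (a i) * η.sum fun j e => f j • e) := by
          rw [Finsupp.mul_sum, Finsupp.sum, Finsupp.sum, ← Finset.sum_neg_distrib]
          exact Finset.sum_congr rfl fun i _ => by simp
        have e2 : (γ.sum fun j e => f j • -(kD x e)) = - kD x (γ.sum fun j e => f j • e) := by
          rw [Finsupp.sum, Finsupp.sum, map_sum, ← Finset.sum_neg_distrib]
          exact Finset.sum_congr rfl fun i _ => by simp
        rw [e1, e2, h2]
        abel
  have h1 := key l hl (by rw [prod_eq_zero a l hlt]; exact zero_mem _)
  apply hx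
  have h2 : T ≤ Submodule.comap ((ExteriorAlgebra.algebraMapInv :
      ExteriorAlgebra S (Fin n → S) →ₐ[S] S).toLinearMap) (Ideal.span (Set.range x)) := by
    refine sup_le ?_ ?_
    · refine Submodule.smul_le.2 fun r hr e _ => ?_
      have hr' : r ∈ Ideal.span (Set.range x) := by
        refine (Ideal.span_le.2 ?_) hr
        rintro _ ⟨i, rfl⟩
        rw [← hf, kd_apply]
        exact sum_mem fun j _ => Ideal.mul_mem_left _ _ (Ideal.subset_span ⟨j, rfl⟩)
      simp only [Submodule.mem_comap, map_smul, smul_eq_mul]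
      exact Ideal.mul_mem_right _ _ hr'
    · rintro _ ⟨w, rfl⟩
      exact inv_kD x w
  simpa using h2 h1

end Koszul
end CST

namespace CST
section Inv
variable {k : Type*} [Field k] {n : ℕ} {G : Type*} [Group G]
  (σ : G →* (MvPolynomial (Fin n) k ≃ₐ[k] MvPolynomial (Fin n) k))
  (H : Subgroup G)

lemma mem_inv (x : MvPolynomial (Fin n) k) :
    x ∈ invariantSubalgebra σ H ↔ ∀ h ∈ H, σ h x = x := Iff.rfl

lemma sigma_eq_aeval (g : G) (p : MvPolynomial (Fin n) k) :
    σ g p = aeval (fun i => σ g (X i)) p := by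
  have : (σ g).toAlgHom = aeval (fun i => σ g (X i)) := by
    refine MvPolynomial.algHom_ext fun i => ?_
    simp
  rw [← this]
  rfl

variable (hlin : ∀ g i, (σ g (X i)).IsHomogeneous 1)
include hlin

lemma sigma_hom (g : G) {p : MvPolynomial (Fin n) k} {d : ℕ} (hp : p.IsHomogeneous d) :
    (σ g p).IsHomogeneous d := by
  rw [sigma_eq_aeval]
  simpa using hp.aeval _ (hlin g)

lemma sigma_comp (g : G) (p : MvPolynomial (Fin n) k) (d : ℕ) :
    homogeneousComponent d (σ g p) = σ g (homogeneousComponent d p) := by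
  conv_lhs => rw [← sum_homogeneousComponent p]
  rw [map_sum, map_sum]
  have : ∀ i, homogeneousComponent d (σ g (homogeneousComponent i p)) =
      if i = d then σ g (homogeneousComponent i p) else 0 := fun i => by
    rw [homogeneousComponent_of_mem (m := d) (n := i)]
    · simp [eq_comm]
    · exact sigma_hom σ hlin g (homogeneousComponent_isHomogeneous i p)
  simp_rw [this]
  rw [Finset.sum_ite_eq' (Finset.range (p.totalDegree + 1)) d]
  split_ifs with h
  · rfl
  · rw [homogeneousComponent_eq_zero _ _ (by simpa [Nat.lt_succ_iff] using h), map_zero]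

lemma sigma_totalDegree (g : G) (p : MvPolynomial (Fin n) k) :
    (σ g p).totalDegree ≤ p.totalDegree := by
  conv_lhs => rw [← sum_homogeneousComponent p]
  rw [map_sum]
  refine totalDegree_finsetSum_le fun i hi => ?_
  refine ((sigma_hom σ hlin g (homogeneousComponent_isHomogeneous i p)).totalDegree_le).trans ?_
  simpa [Nat.lt_succ_iff] using hi

omit hlin

/-- The augmentation part of the invariants. -/
noncomputable def Rp : Submodule k (MvPolynomial (Fin n) k) :=
  (Subalgebra.toSubmodule (invariantSubalgebra σ H)) ⊓
    LinearMap.ker (aeval (fun _ => (0 : k)) : MvPolynomial (Fin n) k →ₐ[k] k).toLinearMap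

lemma mem_Rp (x : MvPolynomial (Fin n) k) :
    x ∈ Rp σ H ↔ x ∈ invariantSubalgebra σ H ∧ constantCoeff x = 0 := by
  have : (aeval (fun _ => (0 : k)) : MvPolynomial (Fin n) k →ₐ[k] k) x = constantCoeff x := by
    simp [aeval_eq_constantCoeff_of_vars]
  simp only [Rp, Submodule.mem_inf, Subalgebra.mem_toSubmodule, LinearMap.mem_ker,
    AlgHom.toLinearMap_apply, this]

/-- The Hilbert ideal. -/
noncomputable def II : Ideal (MvPolynomial (Fin n) k) := Ideal.span (Rp σ H)

lemma II_stable (g : G) (hg : g ∈ H) (x : MvPolynomial (Fin n) k) (hx : x ∈ II σ H) :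
    σ g x ∈ II σ H := by
  refine Submodule.span_induction ?_ ?_ ?_ ?_ hx
  · intro y hy
    rw [((mem_Rp σ H y).1 hy).1 g hg]
    exact Ideal.subset_span hy
  · simp
  · intro u v _ _ hu hv
    rw [map_add]; exact add_mem hu hv
  · intro c u _ hu
    rw [smul_eq_mul, map_mul]; exact Ideal.mul_mem_left _ _ hu

variable [Fintype H]

/-- Reynolds operator. -/
noncomputable def rey (p : MvPolynomial (Fin n) k) : MvPolynomial (Fin n) k :=
  C ((Fintype.card H : k)⁻¹) * ∑ h : H, σ h p

lemma rey_mem (p : MvPolynomial (Fin n) k) : rey σ H p ∈ invariantSubalgebra σ H := by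
  intro h hh
  rw [rey, map_mul, map_sum]
  congr 1
  · exact (σ h).commutes _
  · refine Fintype.sum_equiv (Equiv.mulLeft (⟨h, hh⟩ : H)) _ _ fun x => ?_
    simp

lemma rey_rel {κ : Type*} (f : κ → MvPolynomial (Fin n) k)
    (hf : ∀ i, f i ∈ invariantSubalgebra σ H)
    (p : κ → MvPolynomial (Fin n) k) (t : Finset κ) (h : ∑ i ∈ t, p i * f i = 0) :
    ∑ i ∈ t, rey σ H (p i) * f i = 0 := by
  have : ∀ g : H, ∑ i ∈ t, σ g (p i) * f i = 0 := fun g => by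
    have := congrArg (σ g) h
    rw [map_sum, map_zero] at this
    rw [← this]
    refine Finset.sum_congr rfl fun i _ => ?_
    rw [map_mul, hf i g g.2]
  simp_rw [rey, mul_assoc, ← Finset.mul_sum, Finset.sum_mul]
  rw [Finset.sum_comm]
  simp [this]

lemma rey_sub_mem (hc : (Fintype.card H : k) ≠ 0) (p : MvPolynomial (Fin n) k)
    (J : Ideal (MvPolynomial (Fin n) k)) (h : ∀ g ∈ H, σ g p - p ∈ J) : rey σ H p - p ∈ J := by
  have : rey σ H p - p = C ((Fintype.card H : k)⁻¹) * ∑ h : H, (σ h p - p) := by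
    rw [Finset.sum_sub_distrib, mul_sub, rey]
    congr 1
    rw [Finset.sum_const, Finset.card_univ, nsmul_eq_mul, ← mul_assoc,
      ← map_natCast (C : k →+* MvPolynomial (Fin n) k), ← map_mul, inv_mul_cancel₀ hc, map_one, one_mul]
  rw [this]
  exact Ideal.mul_mem_left _ _ (sum_mem fun g _ => h g g.2)

include hlin in
/-- Chevalley's lemma. -/
theorem chevalley (hc : (Fintype.card H : k) ≠ 0) (T : Set G) (hT : H = Subgroup.closure T)
    (href : ∀ g ∈ T, ∃ l : MvPolynomial (Fin n) k, l ≠ 0 ∧ l.IsHomogeneous 1 ∧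
      ∀ p, l ∣ σ g p - p)
    {κ : Type*} (f : κ → MvPolynomial (Fin n) k)
    (hf : ∀ i, f i ∈ invariantSubalgebra σ H) (t : Finset κ)
    (hmin : ∀ c : κ → MvPolynomial (Fin n) k, (∀ i, c i ∈ invariantSubalgebra σ H) →
      ∑ i ∈ t, c i * f i = 0 → ∀ i ∈ t, constantCoeff (c i) = 0) (N : ℕ) :
    ∀ p : κ → MvPolynomial (Fin n) k, ∑ i ∈ t, p i * f i = 0 → ∀ i ∈ t,
      (p i).totalDegree ≤ N → p i ∈ II σ H := by
  induction N using Nat.strong_induction_on with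
  | _ N ih =>
  intro p hp i hi hN
  have hTp : ∀ g ∈ T, σ g (p i) - p i ∈ II σ H := by
    intro g hg
    have hgH : g ∈ H := by rw [hT]; exact Subgroup.subset_closure hg
    obtain ⟨l, l0, l1, hl⟩ := href g hg
    choose q hq using fun j => hl (p j)
    have hqrel : ∑ j ∈ t, q j * f j = 0 := by
      have h1 : l * ∑ j ∈ t, q j * f j = 0 := by
        have h2 := congrArg (σ g) hp
        rw [map_sum, map_zero] at h2
        calc l * ∑ j ∈ t, q j * f j = ∑ j ∈ t, (σ g (p j * f j) - p j * f j) := by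
              rw [Finset.mul_sum]
              refine Finset.sum_congr rfl fun j _ => ?_
              rw [map_mul, hf j g hgH, ← sub_mul, hq, mul_assoc]
          _ = 0 := by rw [Finset.sum_sub_distrib, h2, hp, sub_zero]
      exact (mul_eq_zero.1 h1).resolve_left l0
    rw [hq]
    refine Ideal.mul_mem_left _ _ ?_
    by_cases q0 : q i = 0
    · rw [q0]; exact zero_mem _
    · have hd : (σ g (p i) - p i).totalDegree ≤ N :=
        (totalDegree_sub _ _).trans (max_le ((sigma_totalDegree σ hlin g _).trans hN) hN)
      rw [hq, totalDegree_mul_of_isDomain l0 q0, l1.totalDegree l0] at hd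
      exact ih (N - 1) (by omega) q hqrel i hi (by omega)
  have hHp : ∀ g ∈ H, σ g (p i) - p i ∈ II σ H := by
    intro g hg
    have hg' := hg
    rw [hT] at hg'
    induction hg' using Subgroup.closure_induction with
    | mem g h => exact hTp g h
    | one => simp
    | mul a b ha hb iha ihb =>
      rw [← hT] at ha hb
      have := add_mem (II_stable σ H a ha _ (ihb hb)) (iha ha)
      rw [map_sub] at this
      simpa using this
    | inv a ha iha =>
      rw [← hT] at ha
      have := neg_mem (II_stable σ H a⁻¹ (H.inv_mem ha) _ (iha ha))
      rw [map_sub, ← AlgEquiv.mul_apply, ← map_mul, inv_mul_cancel, map_one] at this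
      simpa using this
  have h1 := rey_sub_mem σ H hc (p i) _ hHp
  have h2 : rey σ H (p i) ∈ II σ H := by
    refine Ideal.subset_span ((mem_Rp σ H _).2 ⟨rey_mem σ H _, ?_⟩)
    exact hmin (fun j => rey σ H (p j)) (fun j => rey_mem σ H _)
      (rey_rel σ H f hf p t hp) i hi
  have := sub_mem h2 h1
  simpa using this

end Inv
end CST

namespace CST
section Orbit
variable {k : Type*} [Field k] {n : ℕ} {G : Type*} [Group G]
  (σ : G →* (MvPolynomial (Fin n) k ≃ₐ[k] MvPolynomial (Fin n) k))
  (H : Subgroup G) [Fintype H]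

/-- The orbit polynomial. -/
noncomputable def orb (x : MvPolynomial (Fin n) k) : Polynomial (MvPolynomial (Fin n) k) :=
  ∏ h : H, (Polynomial.X - Polynomial.C (σ h x))

lemma orb_coeff (x : MvPolynomial (Fin n) k) (i : ℕ) :
    (orb σ H x).coeff i ∈ invariantSubalgebra σ H := by
  intro h hh
  have : (orb σ H x).map ((σ h : MvPolynomial (Fin n) k ≃ₐ[k] MvPolynomial (Fin n) k) :
      MvPolynomial (Fin n) k →+* MvPolynomial (Fin n) k) = orb σ H x := by
    rw [orb, Polynomial.map_prod]
    refine Fintype.prod_equiv (Equiv.mulLeft (⟨h, hh⟩ : H)) _ _ fun y => ?_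
    simp
  conv_rhs => rw [← this]
  rw [Polynomial.coeff_map]
  rfl

lemma orb_monic (x : MvPolynomial (Fin n) k) : (orb σ H x).Monic :=
  Polynomial.monic_prod_of_monic _ _ fun _ _ => Polynomial.monic_X_sub_C _

lemma orb_eval (x : MvPolynomial (Fin n) k) : (orb σ H x).eval x = 0 := by
  rw [orb, Polynomial.eval_prod]
  exact Finset.prod_eq_zero (Finset.mem_univ 1) (by simp)

lemma integral : Algebra.IsIntegral (invariantSubalgebra σ H) (MvPolynomial (Fin n) k) := by
  refine ⟨fun x => ?_⟩
  have h1 : orb σ H x ∈ Polynomial.lifts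
      (algebraMap (invariantSubalgebra σ H) (MvPolynomial (Fin n) k)) := by
    rw [Polynomial.lifts_iff_coeff_lifts]
    exact fun i => ⟨⟨_, orb_coeff σ H x i⟩, rfl⟩
  obtain ⟨q, hq, -, hm⟩ := Polynomial.lifts_and_natDegree_eq_and_monic h1 (orb_monic σ H x)
  refine ⟨q, hm, ?_⟩
  rw [← Polynomial.eval_map, hq, orb_eval]

theorem faithful [Infinite k] [Finite G] (hinj : Function.Injective σ) (g : G)
    (hg : ∀ x ∈ invariantSubalgebra σ H, σ g x = x) : g ∈ H := by
  classical
  obtain ⟨x, hx⟩ : ∃ x : MvPolynomial (Fin n) k, ∀ a : G, σ a x = x → a = 1 := by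
    by_contra! hcon
    have hcov : ⋃ a : {a : G // a ≠ 1}, ((LinearMap.ker ((σ a.1).toLinearMap - LinearMap.id) :
        Subspace k (MvPolynomial (Fin n) k)) : Set (MvPolynomial (Fin n) k)) = Set.univ := by
      refine Set.eq_univ_of_forall fun x => ?_
      obtain ⟨a, ha, h1⟩ := hcon x
      exact Set.mem_iUnion.2 ⟨⟨a, h1⟩, by simp [ha]⟩
    obtain ⟨⟨a, ha⟩, htop⟩ := Subspace.exists_eq_top_of_iUnion_eq_univ hcov
    refine ha (hinj ?_)
    rw [map_one]
    ext1 y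
    have : y ∈ LinearMap.ker ((σ a).toLinearMap - LinearMap.id) := by
      have h2 := htop ▸ (Submodule.mem_top : y ∈ ⊤)
      exact h2
    simpa [sub_eq_zero] using this
  have h1 : (orb σ H x).map ((σ g : MvPolynomial (Fin n) k ≃ₐ[k] MvPolynomial (Fin n) k) :
      MvPolynomial (Fin n) k →+* MvPolynomial (Fin n) k) = orb σ H x := by
    ext1 i
    rw [Polynomial.coeff_map]
    exact hg _ (orb_coeff σ H x i)
  have h2 : (orb σ H x).eval (σ g x) = 0 := by
    rw [← h1]
    have := Polynomial.eval_map_apply (p := orb σ H x)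
      ((σ g : MvPolynomial (Fin n) k ≃ₐ[k] MvPolynomial (Fin n) k) :
      MvPolynomial (Fin n) k →+* MvPolynomial (Fin n) k) x
    rw [orb_eval, map_zero] at this
    exact this
  rw [orb, Polynomial.eval_prod, Finset.prod_eq_zero_iff] at h2
  obtain ⟨h, -, hh⟩ := h2
  simp only [Polynomial.eval_sub, Polynomial.eval_X, Polynomial.eval_C, sub_eq_zero] at hh
  have h3 : σ ((h : G)⁻¹ * g) x = x := by
    rw [map_mul, AlgEquiv.mul_apply, hh, ← AlgEquiv.mul_apply, ← map_mul]
    simp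
  have h4 := hx _ h3
  rw [inv_mul_eq_one] at h4
  rw [← h4]
  exact h.2

end Orbit

section Gens
variable {k : Type*} [Field k] {n : ℕ} {G : Type*} [Group G]
  (σ : G →* (MvPolynomial (Fin n) k ≃ₐ[k] MvPolynomial (Fin n) k))
  (H : Subgroup G)
  (hlin : ∀ g i, (σ g (X i)).IsHomogeneous 1)

include hlin in
lemma comp_mem (x : MvPolynomial (Fin n) k) (hx : x ∈ invariantSubalgebra σ H) (d : ℕ) :
    homogeneousComponent d x ∈ invariantSubalgebra σ H := by
  intro h hh
  rw [← sigma_comp σ hlin, hx h hh]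

include hlin in
lemma span_hom : Submodule.span k {x | x ∈ Rp σ H ∧ ∃ d, x.IsHomogeneous d} = Rp σ H := by
  refine le_antisymm (Submodule.span_le.2 fun x hx => hx.1) fun x hx => ?_
  rw [← sum_homogeneousComponent x]
  refine sum_mem fun d _ => Submodule.subset_span ⟨?_, d, homogeneousComponent_isHomogeneous d x⟩
  rw [mem_Rp] at hx ⊢
  refine ⟨comp_mem σ H hlin x hx.1 d, ?_⟩
  have := hx.2
  rw [constantCoeff_eq] at this ⊢
  rw [coeff_homogeneousComponent, this]
  simp

lemma comp_of_hom {x : MvPolynomial (Fin n) k} {d : ℕ} (hx : x.IsHomogeneous d) (e : ℕ) :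
    homogeneousComponent e x = if e = d then x else 0 :=
  homogeneousComponent_of_mem hx

include hlin in
lemma adjoin_eq {κ : Type*} (f : κ → MvPolynomial (Fin n) k) (hf : ∀ i, f i ∈ Rp σ H)
    (hhom : ∀ i, ∃ d, (f i).IsHomogeneous d)
    (hsp : Rp σ H ≤ Submodule.span k (Set.range f) ⊔ Rp σ H * Rp σ H) :
    Algebra.adjoin k (Set.range f) = invariantSubalgebra σ H := by
  refine le_antisymm (Algebra.adjoin_le ?_) ?_
  · rintro _ ⟨i, rfl⟩
    exact ((mem_Rp σ H _).1 (hf i)).1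
  have key : ∀ d, ∀ x ∈ invariantSubalgebra σ H, x.IsHomogeneous d →
      x ∈ Algebra.adjoin k (Set.range f) := by
    intro d
    induction d using Nat.strong_induction_on with
    | _ d ih =>
    intro x hx hxd
    by_cases hd : d = 0
    · subst hd
      have : x = C (coeff 0 x) := by
        rw [← homogeneousComponent_zero, homogeneousComponent_eq_self hxd]
      rw [this]
      exact Subalgebra.algebraMap_mem _ _
    · have hxR : x ∈ Rp σ H := by
        rw [mem_Rp]
        refine ⟨hx, ?_⟩
        rw [constantCoeff_eq]
        exact hxd.coeff_eq_zero (by simpa using Ne.symm hd)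
      have hle : Submodule.span k (Set.range f) ⊔ Rp σ H * Rp σ H ≤
          (Subalgebra.toSubmodule (Algebra.adjoin k (Set.range f))).comap
            (homogeneousComponent d) := by
        refine sup_le (Submodule.span_le.2 ?_) ?_
        · rintro _ ⟨i, rfl⟩
          obtain ⟨e, he⟩ := hhom i
          simp only [SetLike.mem_coe, Submodule.mem_comap, Subalgebra.mem_toSubmodule]
          rw [comp_of_hom he]
          split_ifs
          · exact Algebra.subset_adjoin ⟨i, rfl⟩
          · exact zero_mem _
        · rw [← span_hom σ H hlin, Submodule.span_mul_span, Submodule.span_le]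
          rintro _ ⟨u, ⟨hu, a, ha⟩, v, ⟨hv, b, hb⟩, rfl⟩
          simp only [SetLike.mem_coe, Submodule.mem_comap, Subalgebra.mem_toSubmodule]
          rw [comp_of_hom (ha.mul hb)]
          split_ifs with hab
          · have pos : ∀ (w : MvPolynomial (Fin n) k) (c : ℕ), w ∈ Rp σ H → w.IsHomogeneous c →
                w = 0 ∨ 0 < c := by
              intro w c hw hc
              rcases Nat.eq_zero_or_pos c with rfl | h
              · left
                have h1 := ((mem_Rp σ H w).1 hw).2
                rw [constantCoeff_eq] at h1
                rw [← homogeneousComponent_eq_self hc, homogeneousComponent_zero, h1, C_0]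
              · exact Or.inr h
            rcases pos u a hu ha with rfl | ha0
            · simp
            rcases pos v b hv hb with rfl | hb0
            · simp
            exact mul_mem (ih a (by omega) u ((mem_Rp σ H u).1 hu).1 ha)
              (ih b (by omega) v ((mem_Rp σ H v).1 hv).1 hb)
          · exact zero_mem _
      have := hle (hsp hxR)
      simp only [Submodule.mem_comap, Subalgebra.mem_toSubmodule] at this
      rwa [homogeneousComponent_eq_self hxd] at this
  intro x hx
  rw [← sum_homogeneousComponent x]
  exact sum_mem fun d _ => key d _ (comp_mem σ H hlin x hx d)
    (homogeneousComponent_isHomogeneous d x)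

lemma II_eq {κ : Type*} (f : κ → MvPolynomial (Fin n) k) (hf : ∀ i, f i ∈ Rp σ H)
    (had : Algebra.adjoin k (Set.range f) = invariantSubalgebra σ H) :
    II σ H = Ideal.span (Set.range f) := by
  refine le_antisymm (Ideal.span_le.2 ?_) (Ideal.span_le.2 ?_)
  · intro x hx
    rw [SetLike.mem_coe, mem_Rp, ← had] at hx
    have : x - C (constantCoeff x) ∈ Ideal.span (Set.range f) := by
      refine Algebra.adjoin_induction (p := fun x _ => x - C (constantCoeff x) ∈
        Ideal.span (Set.range f)) ?_ ?_ ?_ ?_ hx.1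
      · rintro _ ⟨i, rfl⟩
        rw [((mem_Rp σ H _).1 (hf i)).2, C_0, sub_zero]
        exact Ideal.subset_span ⟨i, rfl⟩
      · intro r
        simp [algebraMap_eq]
      · intro u v _ _ hu hv
        have := add_mem hu hv
        convert this using 1
        simp only [map_add]; ring
      · intro u v _ _ hu hv
        have := add_mem (Ideal.mul_mem_left _ u hv) (Ideal.mul_mem_left _ (C (constantCoeff v)) hu)
        convert this using 1
        simp only [map_mul]; ring
    simpa [hx.2] using this
  · rintro _ ⟨i, rfl⟩
    exact Ideal.subset_span (hf i)

lemma hmin {κ : Type*} (f : κ → MvPolynomial (Fin n) k) (hf : ∀ i, f i ∈ Rp σ H)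
    (hli : LinearIndependent k fun i => (Rp σ H * Rp σ H).mkQ (f i)) (t : Finset κ)
    (c : κ → MvPolynomial (Fin n) k) (hc : ∀ i, c i ∈ invariantSubalgebra σ H)
    (h : ∑ i ∈ t, c i * f i = 0) : ∀ i ∈ t, constantCoeff (c i) = 0 := by
  refine linearIndependent_iff'.1 hli t _ ?_
  have h1 : ∑ i ∈ t, constantCoeff (c i) • f i ∈ Rp σ H * Rp σ H := by
    have h2 : ∑ i ∈ t, constantCoeff (c i) • f i =
        - ∑ i ∈ t, (c i - C (constantCoeff (c i))) * f i := by
      simp_rw [sub_mul, Finset.sum_sub_distrib, h, smul_eq_C_mul]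
      simp
    rw [h2]
    refine neg_mem (sum_mem fun i _ => Submodule.mul_mem_mul ?_ (hf i))
    rw [mem_Rp]
    exact ⟨sub_mem (hc i) (Subalgebra.algebraMap_mem _ _), by simp⟩
  rw [← (Submodule.Quotient.mk_eq_zero _).2 h1, ← Submodule.mkQ_apply, map_sum]
  simp

lemma exists_coords (p : MvPolynomial (Fin n) k) (hp : constantCoeff p = 0) :
    ∃ a : Fin n → MvPolynomial (Fin n) k, kd X a = p := by
  have h : p ∈ Ideal.span (Set.range (X : Fin n → MvPolynomial (Fin n) k)) := by
    rw [← Set.image_univ, mem_ideal_span_X_image]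
    intro m hm
    by_contra! hcon
    have : m = 0 := by ext i; simpa using hcon i
    subst this
    rw [MvPolynomial.mem_support_iff] at hm
    exact hm hp
  obtain ⟨a, ha⟩ := (Ideal.mem_span_range_iff_exists_fun).1 h
  exact ⟨a, by rw [kd_apply, ha]⟩

include hlin in
theorem poly [Fintype H] (hc : (Fintype.card H : k) ≠ 0) (T : Set G)
    (hT : H = Subgroup.closure T)
    (href : ∀ g ∈ T, ∃ l : MvPolynomial (Fin n) k, l ≠ 0 ∧ l.IsHomogeneous 1 ∧
      ∀ p, l ∣ σ g p - p) :
    ∃ (m : ℕ) (r : Fin m → MvPolynomial (Fin n) k), AlgebraicIndependent k r ∧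
        Algebra.adjoin k (Set.range r) = invariantSubalgebra σ H := by
  classical
  obtain ⟨κ, a, -, hspan, hli⟩ := exists_linearIndependent' k
    (fun x : {x | x ∈ Rp σ H ∧ ∃ d, x.IsHomogeneous d} => (Rp σ H * Rp σ H).mkQ x.1)
  let f : κ → MvPolynomial (Fin n) k := fun i => (a i).1
  have hf : ∀ i, f i ∈ Rp σ H := fun i => (a i).2.1
  have hsp : Rp σ H ≤ Submodule.span k (Set.range f) ⊔ Rp σ H * Rp σ H := by
    have e1 : Set.range ((fun x : {x | x ∈ Rp σ H ∧ ∃ d, x.IsHomogeneous d} =>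
        (Rp σ H * Rp σ H).mkQ x.1) ∘ a) = (Rp σ H * Rp σ H).mkQ '' Set.range f := by
      rw [← Set.range_comp]; rfl
    have e2 : Set.range (fun x : {x | x ∈ Rp σ H ∧ ∃ d, x.IsHomogeneous d} =>
        (Rp σ H * Rp σ H).mkQ x.1) =
        (Rp σ H * Rp σ H).mkQ '' {x | x ∈ Rp σ H ∧ ∃ d, x.IsHomogeneous d} := by
      ext y; simp
    rw [e1, e2, Submodule.span_image, Submodule.span_image, span_hom σ H hlin] at hspan
    have h3 := Submodule.comap_map_mkQ (Rp σ H * Rp σ H) (Submodule.span k (Set.range f))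
    rw [hspan, Submodule.comap_map_mkQ] at h3
    rw [sup_comm, ← h3]
    exact le_sup_right
  have had := adjoin_eq σ H hlin f hf (fun i => (a i).2.2) hsp
  have hII := II_eq σ H f hf had
  choose b hb using fun i => exists_coords (f i) ((mem_Rp σ H _).1 (hf i)).2
  have hlen : ∀ l : List κ, l.Nodup → l.length ≤ n := by
    refine length_le (X : Fin n → MvPolynomial (Fin n) k) f b ?_ hb ?_
    · intro h1
      have h2 : Ideal.span (Set.range (X : Fin n → MvPolynomial (Fin n) k)) ≤
          RingHom.ker (constantCoeff : MvPolynomial (Fin n) k →+* k) := by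
        rw [Ideal.span_le]
        rintro _ ⟨i, rfl⟩
        simp [RingHom.mem_ker]
      simpa [RingHom.mem_ker] using h2 h1
    · intro p hp i
      rw [← hII]
      by_cases hi : i ∈ p.support
      · exact chevalley σ H hlin hc T hT href f (fun i => ((mem_Rp σ H _).1 (hf i)).1) p.support
          (hmin σ H f hf hli p.support) _ p hp i hi le_rfl
      · rw [Finsupp.notMem_support_iff.1 hi]; exact zero_mem _
  have hfin : Finite κ := by
    by_contra hinf
    rw [not_finite_iff_infinite] at hinf
    obtain ⟨s, hs⟩ := Infinite.exists_subset_card_eq κ (n + 1)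
    have := hlen s.toList s.nodup_toList
    rw [Finset.length_toList] at this
    omega
  have : Fintype κ := Fintype.ofFinite κ
  have hcardκ : Fintype.card κ ≤ n := by
    have := hlen (Finset.univ : Finset κ).toList (Finset.nodup_toList _)
    rwa [Finset.length_toList] at this
  let e := Fintype.equivFin κ
  have hr : Set.range (f ∘ e.symm) = Set.range f := e.symm.surjective.range_comp f
  refine ⟨Fintype.card κ, f ∘ e.symm, ?_, by rw [hr, had]⟩
  have halg : Algebra.IsAlgebraic (Algebra.adjoin k (Set.range (f ∘ e.symm)))
      (MvPolynomial (Fin n) k) := by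
    rw [hr, had]
    have := integral σ H
    infer_instance
  refine (Algebra.IsAlgebraic.isTranscendenceBasis_of_lift_le_trdeg_of_finite k
    (f ∘ e.symm) ?_).1
  rw [MvPolynomial.trdeg_of_isDomain]
  simpa using hcardκ

end Gens
end CST

namespace CST
section Final
variable {k : Type*} [Field k] {n : ℕ} {G : Type*} [Group G]
  (ρ : G →* ((Fin n → k) ≃ₗ[k] (Fin n → k)))
  (σ : G →* (MvPolynomial (Fin n) k ≃ₐ[k] MvPolynomial (Fin n) k))
  (hσ : ∀ (g : G) (i : Fin n), σ g (X i) =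
      ∑ j : Fin n, C (ρ g⁻¹ (Pi.single j 1) i) * X j)
include hσ

lemma lin (g : G) (i : Fin n) : (σ g (X i)).IsHomogeneous 1 := by
  rw [hσ]
  exact IsHomogeneous.sum _ _ _ fun j _ => isHomogeneous_C_mul_X _ _

omit hσ in
lemma coeff_form (c : Fin n → k) (j : Fin n) :
    coeff (Finsupp.single j 1) (∑ i, C (c i) * X i : MvPolynomial (Fin n) k) = c j := by
  classical
  simp [coeff_sum, coeff_C_mul, coeff_X', Finsupp.single_left_inj]

lemma sigma_inj (hρ : Function.Injective ρ) : Function.Injective σ := by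
  classical
  rw [injective_iff_map_eq_one]
  intro g hg
  have h1 : ρ g⁻¹ = 1 := by
    apply LinearEquiv.toLinearMap_injective
    refine (Pi.basisFun k (Fin n)).ext fun j => ?_
    ext i
    have h2 := hσ g i
    rw [hg] at h2
    have h3 := congrArg (coeff (Finsupp.single j 1)) h2
    rw [coeff_form (fun j => ρ g⁻¹ (Pi.single j 1) i)] at h3
    simp only [Pi.basisFun_apply, LinearEquiv.coe_coe, LinearEquiv.coe_one, id_eq]
    rw [← h3]
    simp [coeff_X', Pi.single_apply, Finsupp.single_left_inj]
  have := hρ (h1.trans (map_one ρ).symm)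
  simpa using this

lemma refl_form (g : G) (hg : finrank k (Fin n → k) =
      finrank k (LinearMap.ker ((ρ g).toLinearMap - LinearMap.id)) + 1) :
    ∃ l : MvPolynomial (Fin n) k, l ≠ 0 ∧ l.IsHomogeneous 1 ∧ ∀ p, l ∣ σ g p - p := by
  classical
  let A : (Fin n → k) →ₗ[k] (Fin n → k) := (ρ g⁻¹).toLinearMap - LinearMap.id
  have hker : LinearMap.ker A = LinearMap.ker ((ρ g).toLinearMap - LinearMap.id) := by
    have hgg : ∀ v, ρ g (ρ g⁻¹ v) = v := fun v => by
      rw [← LinearEquiv.mul_apply, ← map_mul]; simp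
    have hgg' : ∀ v, ρ g⁻¹ (ρ g v) = v := fun v => by
      rw [← LinearEquiv.mul_apply, ← map_mul]; simp
    ext v
    simp only [A, LinearMap.mem_ker, LinearMap.sub_apply, LinearEquiv.coe_coe, LinearMap.id_apply,
      sub_eq_zero]
    constructor
    · intro h
      conv_lhs => rw [← h]
      exact hgg v
    · intro h
      conv_lhs => rw [← h]
      exact hgg' v
  have hrk : finrank k (LinearMap.range A) = 1 := by
    have := LinearMap.finrank_range_add_finrank_ker A
    rw [hker] at this
    omega
  obtain ⟨w, hw0, hw⟩ := finrank_eq_one_iff'.1 hrk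
  choose c hc using fun j : Fin n => hw ⟨A (Pi.single j 1), ⟨_, rfl⟩⟩
  have hc' : ∀ j, A (Pi.single j 1) = c j • (w : Fin n → k) := fun j => by
    have := congrArg Subtype.val (hc j)
    simpa using this.symm
  refine ⟨∑ j, C (c j) * X j, ?_, IsHomogeneous.sum _ _ _ fun j _ => isHomogeneous_C_mul_X _ _, ?_⟩
  · intro h0
    have hA : A = 0 := by
      refine (Pi.basisFun k (Fin n)).ext fun j => ?_
      have h3 := congrArg (coeff (Finsupp.single j 1)) h0
      rw [coeff_form c, coeff_zero] at h3
      rw [Pi.basisFun_apply, hc', h3]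
      simp
    rw [hA, LinearMap.range_zero, finrank_bot] at hrk
    exact zero_ne_one hrk
  · intro p
    induction p using MvPolynomial.induction_on with
    | C r =>
      have : σ g (C r) = C r := (σ g).commutes r
      rw [this, sub_self]
      exact dvd_zero _
    | add u v hu hv =>
      rw [map_add, add_sub_add_comm]
      exact dvd_add hu hv
    | mul_X u i hu =>
      have hX : σ g (X i) - X i = C ((w : Fin n → k) i) * ∑ j, C (c j) * X j := by
        have hv : ∀ j, ρ g⁻¹ (Pi.single j 1) i = (Pi.single j 1 : Fin n → k) i +
            c j * (w : Fin n → k) i := fun j => by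
          have := congrFun (hc' j) i
          simp only [A, LinearMap.sub_apply, LinearEquiv.coe_coe, LinearMap.id_apply, Pi.sub_apply,
            Pi.smul_apply, smul_eq_mul] at this
          rw [← this]; ring
        rw [hσ]
        simp_rw [hv, C_add, add_mul, Finset.sum_add_distrib, Finset.mul_sum]
        have : ∑ j, C ((Pi.single j 1 : Fin n → k) i) * X j = (X i : MvPolynomial (Fin n) k) := by
          rw [Finset.sum_eq_single i]
          · simp
          · intro j _ hj
            simp [Pi.single_apply, Ne.symm hj]
          · simp
        rw [this, add_sub_cancel_left]
        refine Finset.sum_congr rfl fun j _ => ?_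
        rw [C_mul]; ring
      have : σ g (u * X i) - u * X i = (σ g u - u) * σ g (X i) + u * (σ g (X i) - X i) := by
        rw [map_mul]; ring
      rw [this, hX]
      exact dvd_add (hu.mul_right _) ((Dvd.intro_left _ rfl).mul_left _)

end Final
end CST

/-- Over an algebraically closed field `k`, for a faithful linear action of a finite
group `G` on `V = kⁿ` with `|G|` invertible in `k` (inducing the dual action `σ` on
`k[V]`), with `H` the subgroup generated by pseudo-reflections: `k[V]^H` is a
polynomial ring, and the induced action of `G/H` on `k[V]^H` is faithful (any `g`
acting trivially on `k[V]^H` lies in `H`). -/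
theorem stmt16 {k : Type*} [Field k] [IsAlgClosed k] (n : ℕ)
    {G : Type*} [Group G] [Fintype G]
    (ρ : G →* ((Fin n → k) ≃ₗ[k] (Fin n → k))) (hρ : Function.Injective ρ)
    (hcard : (Fintype.card G : k) ≠ 0)
    (σ : G →* (MvPolynomial (Fin n) k ≃ₐ[k] MvPolynomial (Fin n) k))
    (hσ : ∀ (g : G) (i : Fin n), σ g (X i) =
      ∑ j : Fin n, C (ρ g⁻¹ (Pi.single j 1) i) * X j)
    (H : Subgroup G)
    (hH : H = Subgroup.closure {g : G | finrank k (Fin n → k) =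
      finrank k (LinearMap.ker ((ρ g).toLinearMap - LinearMap.id)) + 1}) :
    (∃ (m : ℕ) (r : Fin m → MvPolynomial (Fin n) k), AlgebraicIndependent k r ∧
        Algebra.adjoin k (Set.range r) = invariantSubalgebra σ H) ∧
    (∀ g : G, (∀ x ∈ invariantSubalgebra σ H, σ g x = x) → g ∈ H) := by
  classical
  have hcH : (Fintype.card H : k) ≠ 0 := by
    intro h0
    apply hcard
    have hd : Fintype.card H ∣ Fintype.card G := by
      simpa [Nat.card_eq_fintype_card] using Subgroup.card_subgroup_dvd_card H
    obtain ⟨m, hm⟩ := hd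
    rw [hm, Nat.cast_mul, h0, zero_mul]
  have : Infinite k := IsAlgClosed.instInfinite
  exact ⟨CST.poly σ H (CST.lin ρ σ hσ) hcH _ hH fun g hg => CST.refl_form ρ σ hσ g hg,
    CST.faithful σ H (CST.sigma_inj ρ σ hσ hρ)⟩
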